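/- Let Γ = (R,S) be a finite binary relation. Then for every n ≥ 1, the identity γ_{n+1,n−1}(Γ) − γ_{n+1,n}(Γ) + γ_{n,n+1}(Γ) = γ_{n−1,n+1}(Γ) − γ_{n−1,n}(Γ) + γ_{n,n−1}(Γ) holds. -/

import Mathlib

open Polynomial

namespace Towber

/-- A transformation-pair over `K`: two `K`-linear maps between
finite-dimensional `K`-vector spaces. -/
structure Pair (K : Type) [Field K] where
  E : Type
  V : Type
  [addE : AddCommGroup E]
  [modE : Module K E]
  [finE : FiniteDimensional K E]
  [addV : AddCommGroup V]
  [modV : Module K V]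
  [finV : FiniteDimensional K V]
  mu : E →ₗ[K] V
  nu : E →ₗ[K] V

attribute [instance] Pair.addE Pair.modE Pair.finE Pair.addV Pair.modV Pair.finV

variable (K : Type) [Field K]

/-- Isomorphism of transformation-pairs. -/
def Pair.Iso (τ σ : Pair K) : Prop :=
  ∃ (α : τ.E ≃ₗ[K] σ.E) (β : τ.V ≃ₗ[K] σ.V),
    (∀ x, σ.mu (α x) = β (τ.mu x)) ∧ (∀ x, σ.nu (α x) = β (τ.nu x))

/-- Finite direct sum of transformation-pairs. -/
noncomputable def dSum (ι : Type) [Finite ι] (τ : ι → Pair K) : Pair K :=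
  letI := Fintype.ofFinite ι
  { E := ∀ i, (τ i).E
    V := ∀ i, (τ i).V
    mu := LinearMap.pi fun i => (τ i).mu ∘ₗ LinearMap.proj i
    nu := LinearMap.pi fun i => (τ i).nu ∘ₗ LinearMap.proj i }

/-- Binary direct sum of transformation-pairs. -/
noncomputable def dSum2 (τ σ : Pair K) : Pair K where
  E := τ.E × σ.E
  V := τ.V × σ.V
  mu := τ.mu.prodMap σ.mu
  nu := τ.nu.prodMap σ.nu

/-- A transformation-pair built from a pair of matrices. -/
noncomputable def ofMats {a b : ℕ} (M N : Matrix (Fin b) (Fin a) K) : Pair K where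
  E := Fin a → K
  V := Fin b → K
  mu := Matrix.toLin' M
  nu := Matrix.toLin' N

/-- `^0T_n = [μ_n, I : K^n → K^n]`, where `μ_n` maps `f_i ↦ f_{i+1}`, `f_n ↦ 0`. -/
noncomputable def zT (n : ℕ) : Pair K :=
  ofMats K (Matrix.of fun j i : Fin n => if (i : ℕ) + 1 = (j : ℕ) then 1 else 0) 1

/-- `T^0_n = [I, μ_n : K^n → K^n]`. -/
noncomputable def Tz (n : ℕ) : Pair K :=
  ofMats K 1 (Matrix.of fun j i : Fin n => if (i : ℕ) + 1 = (j : ℕ) then 1 else 0)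

/-- `T_n = [κ_n, λ_n : K^n → K^{n+1}]`, `κ_n : f_i ↦ f_i`, `λ_n : f_i ↦ f_{i+1}`. -/
noncomputable def Tn (n : ℕ) : Pair K :=
  ofMats K (Matrix.of fun (j : Fin (n+1)) (i : Fin n) => if (j : ℕ) = (i : ℕ) then 1 else 0)
    (Matrix.of fun (j : Fin (n+1)) (i : Fin n) => if (j : ℕ) = (i : ℕ) + 1 then 1 else 0)

/-- `^0T^0_n = [κ'_n, λ'_n : K^{n+1} → K^n]`. -/
noncomputable def zTz (n : ℕ) : Pair K :=
  ofMats K (Matrix.of fun (j : Fin n) (i : Fin (n+1)) => if (j : ℕ) = (i : ℕ) then 1 else 0)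
    (Matrix.of fun (j : Fin n) (i : Fin (n+1)) => if (j : ℕ) + 1 = (i : ℕ) then 1 else 0)

/-- `S(F) = [·X, I : K[X]/(F) → K[X]/(F)]` for a nonzero polynomial `F`. -/
noncomputable def SP (F : Polynomial K) (hF : F ≠ 0) : Pair K :=
  letI : FiniteDimensional K (AdjoinRoot F) := (AdjoinRoot.powerBasis hF).finite
  { E := AdjoinRoot F
    V := AdjoinRoot F
    mu := LinearMap.mulLeft K (AdjoinRoot.root F)
    nu := LinearMap.id }

/-- Membership in Kronecker's list `L(K)` (up to isomorphism). -/
def IsKron (σ : Pair K) : Prop :=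
  (∃ n, 1 ≤ n ∧ Pair.Iso K σ (zT K n)) ∨
  (∃ n, 1 ≤ n ∧ Pair.Iso K σ (Tz K n)) ∨
  (∃ n, Pair.Iso K σ (Tn K n)) ∨
  (∃ n, Pair.Iso K σ (zTz K n)) ∨
  (∃ (p : Polynomial K) (n : ℕ), p.Monic ∧ Irreducible p ∧ p ≠ X ∧ 1 ≤ n ∧
    ∃ h : p ^ n ≠ 0, Pair.Iso K σ (SP K (p ^ n) h))

/-- Being of type `S(p^n)` with `p` monic irreducible, `p ≠ X`, `n ≥ 1`. -/
def IsSType (σ : Pair K) : Prop :=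
  ∃ (p : Polynomial K) (n : ℕ), p.Monic ∧ Irreducible p ∧ p ≠ X ∧ 1 ≤ n ∧
    ∃ h : p ^ n ≠ 0, Pair.Iso K σ (SP K (p ^ n) h)

/-- Membership in Weierstrass' (regular) part of Kronecker's list. -/
def IsKronReg (σ : Pair K) : Prop :=
  (∃ n, 1 ≤ n ∧ Pair.Iso K σ (zT K n)) ∨
  (∃ n, 1 ≤ n ∧ Pair.Iso K σ (Tz K n)) ∨
  (∃ (p : Polynomial K) (n : ℕ), p.Monic ∧ Irreducible p ∧ p ≠ X ∧ 1 ≤ n ∧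
    ∃ h : p ^ n ≠ 0, Pair.Iso K σ (SP K (p ^ n) h))

/-- A finite binary relation `(R, S)`. -/
structure BRel where
  S : Type
  R : S → S → Prop
  [fin : Finite S]

attribute [instance] BRel.fin

/-- The generating relation for left contraction:
`y ~ y'` whenever `∃ x, xRy ∧ xRy'`. -/
def BRel.lgen (Γ : BRel) : Γ.S → Γ.S → Prop := fun y y' => ∃ x, Γ.R x y ∧ Γ.R x y'

/-- The generating relation for right contraction:
`x ~ x'` whenever `∃ y, xRy ∧ x'Ry`. -/
def BRel.rgen (Γ : BRel) : Γ.S → Γ.S → Prop := fun x x' => ∃ y, Γ.R x y ∧ Γ.R x' y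

/-- Quotient of a binary relation by (the equivalence relation generated by) `r`:
two classes are related iff some representatives are related. -/
def BRel.quotBy (Γ : BRel) (r : Γ.S → Γ.S → Prop) : BRel where
  S := Quot r
  R := fun α β => ∃ a b, Quot.mk r a = α ∧ Quot.mk r b = β ∧ Γ.R a b

/-- Left contraction `C_l Γ`. -/
def BRel.Cl (Γ : BRel) : BRel := Γ.quotBy Γ.lgen

/-- Right contraction `C_r Γ`. -/
def BRel.Cr (Γ : BRel) : BRel := Γ.quotBy Γ.rgen

/-- Graph-isomorphism of binary relations. -/
def BRel.Iso (Γ Δ : BRel) : Prop :=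
  ∃ φ : Γ.S ≃ Δ.S, ∀ a b, Δ.R (φ a) (φ b) ↔ Γ.R a b

/-- `γ_{m,n}(Γ)`, the number of vertices of `C_l^m C_r^n Γ`. -/
noncomputable def BRel.gamma (Γ : BRel) (m n : ℕ) : ℕ :=
  Nat.card ((BRel.Cl^[m] (BRel.Cr^[n] Γ)).S)

/-- `Γ` has stabilized at `N`: for all `m, n ≥ N` the iterated contraction
`C_l^m C_r^n Γ` is graph-isomorphic to `C_l^N C_r^N Γ`. -/
def BRel.StabAt (Γ : BRel) (N : ℕ) : Prop :=
  ∀ m, N ≤ m → ∀ n, N ≤ n →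
    BRel.Iso (BRel.Cl^[m] (BRel.Cr^[n] Γ)) (BRel.Cl^[N] (BRel.Cr^[N] Γ))

/-- Number of edges of a binary relation. -/
noncomputable def BRel.edges (Γ : BRel) : ℕ :=
  Nat.card {p : Γ.S × Γ.S // Γ.R p.1 p.2}

/-- The `K`-linearization of a finite binary relation. -/
noncomputable def BRel.linz (Γ : BRel) : Pair K :=
  letI := Fintype.ofFinite Γ.S
  letI := Classical.decEq Γ.S
  letI : DecidablePred (fun p : Γ.S × Γ.S => Γ.R p.1 p.2) := Classical.decPred _
  { E := {p : Γ.S × Γ.S // Γ.R p.1 p.2} → K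
    V := Γ.S → K
    mu := Matrix.toLin' (Matrix.of fun (v : Γ.S) (e : {p : Γ.S × Γ.S // Γ.R p.1 p.2}) =>
      if e.1.1 = v then 1 else 0)
    nu := Matrix.toLin' (Matrix.of fun (v : Γ.S) (e : {p : Γ.S × Γ.S // Γ.R p.1 p.2}) =>
      if e.1.2 = v then 1 else 0) }

/-- The disjoint union of the paths `L_{m i}` (on `m i` vertices) and the
cycles `C_{c j}` (on `c j` vertices). -/
def modelGraph (p q : ℕ) (m : Fin p → ℕ) (c : Fin q → ℕ) : BRel where
  S := (Σ i, Fin (m i)) ⊕ (Σ j, Fin (c j))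
  R := fun x y =>
    (∃ (i : Fin p) (a b : Fin (m i)),
        x = Sum.inl ⟨i, a⟩ ∧ y = Sum.inl ⟨i, b⟩ ∧ (b : ℕ) = (a : ℕ) + 1) ∨
    (∃ (j : Fin q) (a b : Fin (c j)),
        x = Sum.inr ⟨j, a⟩ ∧ y = Sum.inr ⟨j, b⟩ ∧ (b : ℕ) = ((a : ℕ) + 1) % (c j))

/-- A finite directed graph, possibly with parallel edges. -/
structure DiGraph where
  E : Type
  V : Type
  [finE : Finite E]
  [finV : Finite V]
  init : E → V
  term : E → V

attribute [instance] DiGraph.finE DiGraph.finV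

/-- The parallelism relation on the edges of a directed graph. -/
def DiGraph.par (G : DiGraph) : G.E → G.E → Prop :=
  fun e e' => G.init e = G.init e' ∧ G.term e = G.term e'

/-- The reduced form of a directed graph: edges are parallelism classes. -/
def DiGraph.red (G : DiGraph) : DiGraph where
  E := Quot G.par
  V := G.V
  init := Quot.lift G.init fun _ _ h => h.1
  term := Quot.lift G.term fun _ _ h => h.2

/-- The `K`-linearization of a finite directed graph. -/
noncomputable def DiGraph.linz (G : DiGraph) : Pair K :=
  letI := Fintype.ofFinite G.E
  letI := Fintype.ofFinite G.V
  letI := Classical.decEq G.V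
  letI := Classical.decEq G.E
  { E := G.E → K
    V := G.V → K
    mu := Matrix.toLin' (Matrix.of fun (v : G.V) (e : G.E) => if G.init e = v then 1 else 0)
    nu := Matrix.toLin' (Matrix.of fun (v : G.V) (e : G.E) => if G.term e = v then 1 else 0) }

/-- Targets lying in one class for sharing a source have sources lying in one class for
sharing a target. -/
theorem quot_source_eq {α : Type} {R : α → α → Prop} {x x' y y' : α} (h : R x y) (h' : R x' y')
    (hy : Quot.mk (fun b b' => ∃ a, R a b ∧ R a b') y =
      Quot.mk (fun b b' => ∃ a, R a b ∧ R a b') y') :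
    Quot.mk (fun a a' => ∃ b, R a b ∧ R a' b) x =
      Quot.mk (fun a a' => ∃ b, R a b ∧ R a' b) x' := by
  let r : α → α → Prop := fun a a' => ∃ b, R a b ∧ R a' b
  have source_set : ∀ {a b : α}, R a b → {q | ∃ z, R z b ∧ Quot.mk r z = q} = {Quot.mk r a} := by
    intro a b hab
    ext q
    constructor
    · rintro ⟨z, hz, rfl⟩
      exact Quot.sound ⟨b, hz, hab⟩
    · rintro rfl
      exact ⟨a, hab, rfl⟩
  let f : Quot (fun b b' => ∃ a, R a b ∧ R a b') → Set (Quot r) :=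
    Quot.lift (fun b => {q | ∃ z, R z b ∧ Quot.mk r z = q}) (by
      rintro b b' ⟨a, hb, hb'⟩
      exact (source_set hb).trans (source_set hb').symm)
  have hf : f (Quot.mk _ y) = f (Quot.mk _ y') := congrArg f hy
  exact Set.singleton_injective ((source_set h).symm.trans (hf.trans (source_set h')))

/-- A quotient that only identifies elements satisfying `P` preserves the number of elements not
satisfying `P`. -/
theorem card_add_card_quot {α : Type} [Finite α] {r : α → α → Prop} {P : α → Prop}
    (h : ∀ a b, r a b → P a ∧ P b) :
    Nat.card α + Nat.card {q : Quot r // ∃ a, Quot.mk r a = q ∧ P a} =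
      Nat.card (Quot r) + Nat.card {a // P a} := by
  classical
  have eqv : ∀ {a b}, Relation.EqvGen r a b → a = b ∨ (P a ∧ P b) := by
    intro a b hab
    induction hab with
    | rel _ _ hr => exact Or.inr (h _ _ hr)
    | refl => exact Or.inl rfl
    | symm _ _ _ ih => grind
    | trans _ _ _ _ _ ih₁ ih₂ => grind
  have mk_iff : ∀ a, (∃ b, Quot.mk r b = Quot.mk r a ∧ P b) ↔ P a := by
    intro a
    refine ⟨?_, fun ha => ⟨a, rfl, ha⟩⟩
    rintro ⟨b, hb, hP⟩
    rcases eqv (Quot.eqvGen_exact hb) with rfl | hab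
    · exact hP
    · exact hab.2
  have compl : Nat.card {a // ¬ P a} =
      Nat.card {q : Quot r // ¬ ∃ a, Quot.mk r a = q ∧ P a} := by
    refine Nat.card_eq_of_bijective
      (fun a => ⟨Quot.mk r a.1, fun hq => a.2 ((mk_iff a.1).1 hq)⟩) ⟨?_, ?_⟩
    · rintro ⟨a, ha⟩ ⟨b, hb⟩ hab
      rcases eqv (Quot.eqvGen_exact (congrArg Subtype.val hab)) with rfl | hab
      · rfl
      · exact absurd hab.1 ha
    · rintro ⟨q, hq⟩
      obtain ⟨a, rfl⟩ := Quot.exists_rep q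
      exact ⟨⟨a, fun ha => hq ((mk_iff a).2 ha)⟩, rfl⟩
  have hα : Nat.card α = Nat.card {a // P a} + Nat.card {a // ¬ P a} := by
    rw [← Nat.card_sum]
    exact Nat.card_congr (Equiv.sumCompl P).symm
  have hq : Nat.card (Quot r) = Nat.card {q : Quot r // ∃ a, Quot.mk r a = q ∧ P a} +
      Nat.card {q : Quot r // ¬ ∃ a, Quot.mk r a = q ∧ P a} := by
    rw [← Nat.card_sum]
    exact Nat.card_congr (Equiv.sumCompl _).symm
  omega

namespace BRel

instance (Γ : BRel) (r : Γ.S → Γ.S → Prop) : Finite (Quot r) :=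
  (Γ.quotBy r).fin

theorem Iso.refl (Γ : BRel) : Iso Γ Γ := ⟨Equiv.refl _, fun _ _ => Iff.rfl⟩

theorem Iso.symm {Γ Δ : BRel} : Iso Γ Δ → Iso Δ Γ := by
  rintro ⟨φ, h⟩
  exact ⟨φ.symm, fun a b => by simp [← h]⟩

theorem Iso.trans {Γ Δ Θ : BRel} : Iso Γ Δ → Iso Δ Θ → Iso Γ Θ := by
  rintro ⟨φ, h⟩ ⟨ψ, k⟩
  exact ⟨φ.trans ψ, fun a b => (k _ _).trans (h _ _)⟩

theorem quotBy_congr {Γ Δ : BRel} {r : Γ.S → Γ.S → Prop} {s : Δ.S → Δ.S → Prop} (φ : Γ.S ≃ Δ.S)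
    (h : ∀ a b, Δ.R (φ a) (φ b) ↔ Γ.R a b) (hrs : ∀ a b, r a b ↔ s (φ a) (φ b)) :
    Iso (Γ.quotBy r) (Δ.quotBy s) := by
  have mk : ∀ a, Quot.congr φ hrs (Quot.mk r a) = Quot.mk s (φ a) := fun _ => rfl
  refine ⟨Quot.congr φ hrs, fun p q => ?_⟩
  constructor
  · rintro ⟨a, b, ha, hb, hab⟩
    obtain ⟨a, rfl⟩ := φ.surjective a
    obtain ⟨b, rfl⟩ := φ.surjective b
    exact ⟨a, b, (Quot.congr φ hrs).injective ha, (Quot.congr φ hrs).injective hb, (h _ _).1 hab⟩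
  · rintro ⟨a, b, rfl, rfl, hab⟩
    exact ⟨φ a, φ b, rfl, rfl, (h _ _).2 hab⟩

theorem Iso.Cl {Γ Δ : BRel} : Iso Γ Δ → Iso Γ.Cl Δ.Cl := by
  rintro ⟨φ, h⟩
  exact quotBy_congr φ h fun a b => by simp [lgen, ← h, φ.surjective.exists]

theorem Iso.Cr {Γ Δ : BRel} : Iso Γ Δ → Iso Γ.Cr Δ.Cr := by
  rintro ⟨φ, h⟩
  exact quotBy_congr φ h fun a b => by simp [rgen, ← h, φ.surjective.exists]

/-- The vertices with an incoming edge. -/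
abbrev Target (Γ : BRel) : Type := {y : Γ.S // ∃ x, Γ.R x y}

/-- The vertices with an outgoing edge. -/
abbrev Source (Γ : BRel) : Type := {x : Γ.S // ∃ y, Γ.R x y}

theorem Iso.card_target {Γ Δ : BRel} : Iso Γ Δ → Nat.card Γ.Target = Nat.card Δ.Target := by
  rintro ⟨φ, h⟩
  exact Nat.card_congr (φ.subtypeEquiv fun a => by simp [← h, φ.surjective.exists])

theorem card_add_card_target_Cl (Γ : BRel) :
    Nat.card Γ.S + Nat.card Γ.Cl.Target = Nat.card Γ.Cl.S + Nat.card Γ.Target := by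
  have key := card_add_card_quot (r := Γ.lgen) (P := fun y => ∃ x, Γ.R x y)
    (fun a b ⟨x, ha, hb⟩ => ⟨⟨x, ha⟩, ⟨x, hb⟩⟩)
  have classes : Nat.card Γ.Cl.Target =
      Nat.card {q : Quot Γ.lgen // ∃ a, Quot.mk Γ.lgen a = q ∧ ∃ x, Γ.R x a} := by
    refine Nat.card_congr (Equiv.subtypeEquivRight fun q => ?_)
    constructor
    · rintro ⟨p, a, b, -, hb, hab⟩
      exact ⟨b, hb, a, hab⟩
    · rintro ⟨b, hb, a, hab⟩
      exact ⟨_, a, b, rfl, hb, hab⟩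
  rw [classes]
  exact key

theorem card_add_card_source_Cr (Γ : BRel) :
    Nat.card Γ.S + Nat.card Γ.Cr.Source = Nat.card Γ.Cr.S + Nat.card Γ.Source := by
  have key := card_add_card_quot (r := Γ.rgen) (P := fun x => ∃ y, Γ.R x y)
    (fun a b ⟨y, ha, hb⟩ => ⟨⟨y, ha⟩, ⟨y, hb⟩⟩)
  have classes : Nat.card Γ.Cr.Source =
      Nat.card {q : Quot Γ.rgen // ∃ a, Quot.mk Γ.rgen a = q ∧ ∃ y, Γ.R a y} := by
    refine Nat.card_congr (Equiv.subtypeEquivRight fun q => ?_)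
    constructor
    · rintro ⟨p, a, b, ha, -, hab⟩
      exact ⟨a, ha, b, hab⟩
    · rintro ⟨a, ha, b, hab⟩
      exact ⟨_, a, b, ha, rfl, hab⟩
  rw [classes]
  exact key

theorem mk_lgen_eq_iff {Γ : BRel} {x x' y y' : Γ.S} (h : Γ.R x y) (h' : Γ.R x' y') :
    Quot.mk Γ.lgen y = Quot.mk Γ.lgen y' ↔ Quot.mk Γ.rgen x = Quot.mk Γ.rgen x' :=
  ⟨quot_source_eq h h', quot_source_eq (R := fun a b => Γ.R b a) h h'⟩

/-- Both sides count the nontrivial components of the bipartite graph of `Γ`. -/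
theorem card_target_Cl_eq_card_source_Cr (Γ : BRel) :
    Nat.card Γ.Cl.Target = Nat.card Γ.Cr.Source := by
  have rep : ∀ q : Γ.Cl.Target, ∃ x y, Quot.mk Γ.lgen y = q.1 ∧ Γ.R x y := by
    rintro ⟨q, p, a, b, -, hb, hab⟩
    exact ⟨a, b, hb, hab⟩
  choose x y hy hR using rep
  refine Nat.card_eq_of_bijective
    (fun q => ⟨Quot.mk Γ.rgen (x q), Quot.mk Γ.rgen (y q), x q, y q, rfl, rfl, hR q⟩) ⟨?_, ?_⟩
  · intro q q' h
    apply Subtype.ext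
    rw [← hy q, ← hy q']
    exact (mk_lgen_eq_iff (hR q) (hR q')).2 (congrArg Subtype.val h)
  · rintro ⟨p, -, a, b, rfl, -, hab⟩
    refine ⟨⟨Quot.mk Γ.lgen b, Quot.mk Γ.lgen a, a, b, rfl, rfl, hab⟩, Subtype.ext ?_⟩
    exact (mk_lgen_eq_iff (hR _) hab).1 (hy _)

theorem Cl_Cr_iso (Γ : BRel) : Iso Γ.Cr.Cl Γ.Cl.Cr := by
  let lr : Γ.S → Γ.Cr.Cl.S := fun a => Quot.mk Γ.Cr.lgen (Quot.mk Γ.rgen a)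
  let rl : Γ.S → Γ.Cl.Cr.S := fun a => Quot.mk Γ.Cl.rgen (Quot.mk Γ.lgen a)
  have lr_l : ∀ a b, Γ.lgen a b → lr a = lr b := by
    rintro a b ⟨x, ha, hb⟩
    exact Quot.sound ⟨Quot.mk _ x, ⟨x, a, rfl, rfl, ha⟩, ⟨x, b, rfl, rfl, hb⟩⟩
  have rl_r : ∀ a b, Γ.rgen a b → rl a = rl b := by
    rintro a b ⟨y, ha, hb⟩
    exact Quot.sound ⟨Quot.mk _ y, ⟨a, y, rfl, rfl, ha⟩, ⟨b, y, rfl, rfl, hb⟩⟩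
  let f : Γ.Cr.Cl.S → Γ.Cl.Cr.S := Quot.lift (Quot.lift rl rl_r) (by
    rintro _ _ ⟨_, ⟨x, y, hx, rfl, h⟩, ⟨x', y', hx', rfl, h'⟩⟩
    exact congrArg (Quot.mk Γ.Cl.rgen) ((mk_lgen_eq_iff h h').2 (hx.trans hx'.symm)))
  let g : Γ.Cl.Cr.S → Γ.Cr.Cl.S := Quot.lift (Quot.lift lr lr_l) (by
    rintro _ _ ⟨_, ⟨x, y, rfl, hy, h⟩, ⟨x', y', rfl, hy', h'⟩⟩
    exact congrArg (Quot.mk Γ.Cr.lgen) ((mk_lgen_eq_iff h h').1 (hy.trans hy'.symm)))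
  have gf : ∀ p, g (f p) = p := by
    rintro ⟨⟨a⟩⟩
    rfl
  have fg : ∀ p, f (g p) = p := by
    rintro ⟨⟨a⟩⟩
    rfl
  refine ⟨⟨f, g, gf, fg⟩, fun p q => ?_⟩
  constructor
  · rintro ⟨_, _, hp, hq, a, b, rfl, rfl, hab⟩
    refine ⟨Quot.mk _ a, Quot.mk _ b, ?_, ?_, a, b, rfl, rfl, hab⟩
    · exact (congrArg g hp).trans (gf p)
    · exact (congrArg g hq).trans (gf q)
  · rintro ⟨_, _, rfl, rfl, a, b, rfl, rfl, hab⟩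
    exact ⟨Quot.mk _ a, Quot.mk _ b, rfl, rfl, a, b, rfl, rfl, hab⟩

/-- Finite binary relations up to graph-isomorphism. -/
instance isoSetoid : Setoid BRel := ⟨Iso, Iso.refl, Iso.symm, Iso.trans⟩

/-- Left contraction of isomorphism classes. -/
def clClass : Quotient isoSetoid → Quotient isoSetoid := Quotient.map Cl fun _ _ => Iso.Cl

/-- Right contraction of isomorphism classes. -/
def crClass : Quotient isoSetoid → Quotient isoSetoid := Quotient.map Cr fun _ _ => Iso.Cr

/-- Number of vertices of an isomorphism class. -/
noncomputable def cardClass : Quotient isoSetoid → ℕ :=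
  Quotient.lift (fun Γ => Nat.card Γ.S) fun _ _ ⟨φ, _⟩ => Nat.card_congr φ

/-- Number of nontrivial components of the bipartite graph of an isomorphism class. -/
noncomputable def compClass : Quotient isoSetoid → ℕ :=
  Quotient.lift (fun Γ => Nat.card Γ.Cl.Target) fun _ _ h => h.Cl.card_target

theorem commute_clClass_crClass : Function.Commute clClass crClass := by
  rintro ⟨Γ⟩
  exact Quotient.sound (Cl_Cr_iso Γ)

theorem cardClass_cl (q : Quotient isoSetoid) :
    cardClass (clClass q) + compClass (clClass q) =
      cardClass (clClass (clClass q)) + compClass q := by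
  obtain ⟨Γ⟩ := q
  exact card_add_card_target_Cl Γ.Cl

theorem cardClass_cr (q : Quotient isoSetoid) :
    cardClass (crClass q) + compClass (crClass q) =
      cardClass (crClass (crClass q)) + compClass q := by
  obtain ⟨Γ⟩ := q
  have key := card_add_card_source_Cr Γ.Cr
  rw [← card_target_Cl_eq_card_source_Cr, ← card_target_Cl_eq_card_source_Cr] at key
  exact key

theorem gamma_eq_cardClass (Γ : BRel) (m n : ℕ) :
    Γ.gamma m n = cardClass (clClass^[m] (crClass^[n] (Quotient.mk _ Γ))) := by
  have hl : Function.Semiconj (Quotient.mk isoSetoid) Cl clClass := fun _ => rfl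
  have hr : Function.Semiconj (Quotient.mk isoSetoid) Cr crClass := fun _ => rfl
  rw [← (hr.iterate_right n).eq, ← (hl.iterate_right m).eq]
  rfl

theorem gamma_add (Γ : BRel) (k i j : ℕ) :
    Γ.gamma (i + k) (j + k) = cardClass (clClass^[i] (crClass^[j]
      (clClass^[k] (crClass^[k] (Quotient.mk _ Γ))))) := by
  rw [gamma_eq_cardClass, Function.iterate_add_apply, Function.iterate_add_apply,
    (commute_clClass_crClass.iterate_iterate k j).eq]

end BRel

/-- For `n ≥ 1`:
`γ_{n+1,n−1} − γ_{n+1,n} + γ_{n,n+1} = γ_{n−1,n+1} − γ_{n−1,n} + γ_{n,n−1}`. -/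
theorem stmt8 (Γ : BRel) (n : ℕ) (hn : 1 ≤ n) :
    (Γ.gamma (n+1) (n-1) : ℤ) - (Γ.gamma (n+1) n : ℤ) + (Γ.gamma n (n+1) : ℤ) =
      (Γ.gamma (n-1) (n+1) : ℤ) - (Γ.gamma (n-1) n : ℤ) + (Γ.gamma n (n-1) : ℤ) := by
  obtain ⟨k, rfl⟩ : ∃ k, n = k + 1 := ⟨n - 1, by omega⟩
  rw [show k + 1 + 1 = 2 + k by omega, show k + 1 - 1 = 0 + k by omega,
    show k + 1 = 1 + k by omega]
  simp only [BRel.gamma_add]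
  generalize BRel.clClass^[k] (BRel.crClass^[k] (Quotient.mk _ Γ)) = q
  simp only [Function.iterate_succ_apply, Function.iterate_zero_apply]
  have hl := BRel.cardClass_cl q
  have hlr := BRel.cardClass_cl (BRel.crClass q)
  have hr := BRel.cardClass_cr q
  have hrl := BRel.cardClass_cr (BRel.clClass q)
  simp only [← BRel.commute_clClass_crClass.eq] at hrl
  omega


end Towber
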